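/- No minimally nonperfectly divisible claw-free graph contains a clique cutset. -/

import Mathlib

open SimpleGraph

variable {V : Type}

/-- The clique number of the subgraph of `G` induced on `S`. -/
noncomputable def omegaOn (G : SimpleGraph V) (S : Set V) : ℕ :=
  sSup {n | ∃ s : Finset V, ↑s ⊆ S ∧ G.IsNClique n s}

/-- The subgraph of `G` induced on `S` is a perfect graph. -/
def IsPerfectOn (G : SimpleGraph V) (S : Set V) : Prop :=
  ∀ T : Set V, T ⊆ S → (G.induce T).chromaticNumber = (omegaOn G T : ℕ∞)

/-- Every nonempty induced subgraph of `G[S]` admits a perfect division. -/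
def PerfDivOn (G : SimpleGraph V) (S : Set V) : Prop :=
  ∀ H : Set V, H ⊆ S → H.Nonempty →
    ∃ A B : Set V, A ∪ B = H ∧ Disjoint A B ∧
      IsPerfectOn G A ∧ omegaOn G B < omegaOn G H

/-- `G` is minimally nonperfectly divisible. -/
def MNPD (G : SimpleGraph V) : Prop :=
  ¬ PerfDivOn G Set.univ ∧ ∀ S : Set V, S ≠ Set.univ → PerfDivOn G S

/-- The external neighbourhood `N(X)`. -/
def extNbhd (G : SimpleGraph V) (X : Set V) : Set V :=
  {v | v ∉ X ∧ ∃ x ∈ X, G.Adj v x}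

/-- `G` has no induced claw (`K_{1,3}`). -/
def ClawFree (G : SimpleGraph V) : Prop :=
  ¬ ∃ a b c d : V, b ≠ c ∧ b ≠ d ∧ c ≠ d ∧
    G.Adj a b ∧ G.Adj a c ∧ G.Adj a d ∧
    ¬ G.Adj b c ∧ ¬ G.Adj b d ∧ ¬ G.Adj c d

lemma omegaOn_bddAbove [Finite V] (G : SimpleGraph V) (S : Set V) :
    BddAbove {n | ∃ s : Finset V, ↑s ⊆ S ∧ G.IsNClique n s} := by
  have := Fintype.ofFinite V
  refine ⟨Fintype.card V, ?_⟩
  rintro n ⟨s, -, hs⟩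
  rw [← hs.card_eq]
  exact s.card_le_univ

lemma card_le_omegaOn [Finite V] {G : SimpleGraph V} {S : Set V} {s : Finset V}
    (hsS : ↑s ⊆ S) (hs : G.IsClique s) : s.card ≤ omegaOn G S :=
  le_csSup (omegaOn_bddAbove G S) ⟨s, hsS, hs, rfl⟩

lemma exists_card_eq_omegaOn [Finite V] (G : SimpleGraph V) (S : Set V) :
    ∃ s : Finset V, ↑s ⊆ S ∧ G.IsClique s ∧ s.card = omegaOn G S := by
  obtain ⟨s, hsS, hs⟩ := Nat.sSup_mem (s := {n | ∃ s : Finset V, ↑s ⊆ S ∧ G.IsNClique n s})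
    ⟨0, ∅, by simp, by simp [SimpleGraph.isNClique_iff]⟩ (omegaOn_bddAbove G S)
  exact ⟨s, hsS, hs.isClique, hs.card_eq⟩

lemma omegaOn_mono [Finite V] (G : SimpleGraph V) {S T : Set V} (h : S ⊆ T) :
    omegaOn G S ≤ omegaOn G T := by
  obtain ⟨s, hsS, hs, hcard⟩ := exists_card_eq_omegaOn G S
  exact hcard ▸ card_le_omegaOn (hsS.trans h) hs

lemma omegaOn_lt_iff [Finite V] {G : SimpleGraph V} {S : Set V} {n : ℕ} :
    omegaOn G S < n ↔ ∀ s : Finset V, ↑s ⊆ S → G.IsClique s → s.card < n := by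
  refine ⟨fun h s hsS hs => (card_le_omegaOn hsS hs).trans_lt h, fun h => ?_⟩
  obtain ⟨s, hsS, hs, hcard⟩ := exists_card_eq_omegaOn G S
  exact hcard ▸ h s hsS hs

lemma omegaOn_le_chromaticNumber [Finite V] (G : SimpleGraph V) (T : Set V) :
    (omegaOn G T : ℕ∞) ≤ (G.induce T).chromaticNumber := by
  classical
  obtain ⟨s, hsT, hs, hcard⟩ := exists_card_eq_omegaOn G T
  have hclique : (G.induce T).IsClique (s.subtype (· ∈ T) : Finset T) := by
    intro a ha b hb hab
    exact hs (by simpa using ha) (by simpa using hb) (fun h => hab (Subtype.ext h))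
  have hle := hclique.card_le_chromaticNumber
  rwa [Finset.card_subtype, Finset.filter_true_of_mem (fun x hx => hsT hx), hcard] at hle

/-- A graph is perfect iff each induced subgraph can be colored with as many colors as its
clique number. -/
lemma isPerfectOn_iff [Finite V] {G : SimpleGraph V} {S : Set V} :
    IsPerfectOn G S ↔ ∀ T ⊆ S, (G.induce T).Colorable (omegaOn G T) := by
  refine forall₂_congr fun T _ => ⟨fun h => ?_, fun h => ?_⟩
  · exact SimpleGraph.chromaticNumber_le_iff_colorable.1 h.le
  · exact le_antisymm (SimpleGraph.chromaticNumber_le_iff_colorable.2 h)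
      (omegaOn_le_chromaticNumber G T)

lemma IsPerfectOn.mono {G : SimpleGraph V} {S T : Set V} (hT : IsPerfectOn G T) (h : S ⊆ T) :
    IsPerfectOn G S :=
  fun R hR => hT R (hR.trans h)

/-- Gluing two perfect graphs along a clique yields a perfect graph. -/
lemma IsPerfectOn.union [Finite V] {G : SimpleGraph V} {P Q : Set V} (hP : IsPerfectOn G P)
    (hQ : IsPerfectOn G Q) (hPQ : G.IsClique (P ∩ Q))
    (hadj : ∀ u ∈ P \ Q, ∀ v ∈ Q \ P, ¬ G.Adj u v) : IsPerfectOn G (P ∪ Q) := by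
  classical
  rw [isPerfectOn_iff]
  intro T hT
  obtain ⟨c⟩ := (isPerfectOn_iff.1 hP (T ∩ P) Set.inter_subset_right).mono
    (omegaOn_mono G Set.inter_subset_left)
  obtain ⟨d⟩ := (isPerfectOn_iff.1 hQ (T ∩ Q) Set.inter_subset_right).mono
    (omegaOn_mono G Set.inter_subset_left)
  obtain ⟨σ, hσ⟩ := Equiv.Perm.exists_extending_pair
    (fun v : ↥(T ∩ (P ∩ Q)) => d ⟨v, v.2.1, v.2.2.2⟩)
    (fun v : ↥(T ∩ (P ∩ Q)) => c ⟨v, v.2.1, v.2.2.1⟩)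
    (fun u v huv => by
      by_contra hne
      exact d.valid (v := ⟨u, u.2.1, u.2.2.2⟩) (w := ⟨v, v.2.1, v.2.2.2⟩)
        (hPQ u.2.2 v.2.2 fun h => hne (Subtype.ext h)) huv)
    (fun u v huv => by
      by_contra hne
      exact c.valid (v := ⟨u, u.2.1, u.2.2.1⟩) (w := ⟨v, v.2.1, v.2.2.1⟩)
        (hPQ u.2.2 v.2.2 fun h => hne (Subtype.ext h)) huv)
  have hmem (v : T) (h : (v : V) ∉ P) : (v : V) ∈ Q := (hT v.2).resolve_left h
  let f : T → Fin (omegaOn G T) := fun v =>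
    if h : (v : V) ∈ P then c ⟨v, v.2, h⟩ else σ (d ⟨v, v.2, hmem v h⟩)
  have hfP (v : T) (h : (v : V) ∈ P) : f v = c ⟨v, v.2, h⟩ := dif_pos h
  have hfQ (v : T) (h : (v : V) ∈ Q) : f v = σ (d ⟨v, v.2, h⟩) := by
    by_cases hvP : (v : V) ∈ P
    · rw [hfP v hvP]
      exact (hσ ⟨v, v.2, hvP, h⟩).symm
    · exact dif_neg hvP
  refine ⟨SimpleGraph.Coloring.mk f ?_⟩
  intro u v huv heq
  have huv' : G.Adj u v := huv
  by_cases hboth : (u : V) ∈ P ∧ (v : V) ∈ P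
  · rw [hfP u hboth.1, hfP v hboth.2] at heq
    exact c.valid (v := ⟨u, u.2, hboth.1⟩) (w := ⟨v, v.2, hboth.2⟩) huv' heq
  · have huQ : (u : V) ∈ Q := by
      by_contra huQ
      have huP := (hT u.2).resolve_right huQ
      have hvP : (v : V) ∉ P := fun h => hboth ⟨huP, h⟩
      exact hadj u ⟨huP, huQ⟩ v ⟨hmem v hvP, hvP⟩ huv'
    have hvQ : (v : V) ∈ Q := by
      by_contra hvQ
      have hvP := (hT v.2).resolve_right hvQ
      have huP : (u : V) ∉ P := fun h => hboth ⟨h, hvP⟩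
      exact hadj v ⟨hvP, hvQ⟩ u ⟨huQ, huP⟩ huv'.symm
    rw [hfQ u huQ, hfQ v hvQ] at heq
    exact d.valid (v := ⟨u, u.2, huQ⟩) (w := ⟨v, v.2, hvQ⟩) huv' (σ.injective heq)

/-- The complement of a bipartite graph is perfect. -/
lemma isPerfectOn_union_of_isClique [Finite V] {G : SimpleGraph V} {P Q : Set V}
    (hP : G.IsClique P) (hQ : G.IsClique Q) : IsPerfectOn G (P ∪ Q) := by
  classical
  have := Fintype.ofFinite V
  rw [isPerfectOn_iff]
  intro T hT
  let C : Finset V := {v | v ∈ T ∧ v ∈ P}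
  let D : Finset V := {v | v ∈ T ∧ v ∉ P}
  have hCP {v : V} (h : v ∈ C) : v ∈ T ∧ v ∈ P := by simpa [C] using h
  have hDQ {v : V} (h : v ∈ D) : v ∈ T ∧ v ∉ P ∧ v ∈ Q := by
    have h' : v ∈ T ∧ v ∉ P := by simpa [D] using h
    exact ⟨h'.1, h'.2, (hT h'.1).resolve_left h'.2⟩
  have hDω : D.card ≤ omegaOn G T :=
    card_le_omegaOn (fun v hv => (hDQ hv).1) fun u hu v hv => hQ (hDQ hu).2.2 (hDQ hv).2.2
  let t : C → Finset (V ⊕ Fin (omegaOn G T - D.card)) := fun v =>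
    (D.filter fun w => ¬ G.Adj v w).disjSum Finset.univ
  have hall : ∀ s : Finset C, s.card ≤ (s.biUnion t).card := by
    intro s
    obtain rfl | ⟨v₀, hv₀⟩ := s.eq_empty_or_nonempty
    · simp
    let R : Finset V := D.filter fun w => ∀ v ∈ s, G.Adj v w
    let S : Finset V := s.map (Function.Embedding.subtype _)
    have hS {v : V} (hv : v ∈ S) : ∃ h : v ∈ C, ⟨v, h⟩ ∈ s := by simpa [S] using hv
    have hR {w : V} (hw : w ∈ R) : w ∈ D ∧ ∀ v ∈ s, G.Adj v w := Finset.mem_filter.1 hw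
    have hdisj : Disjoint S R := by
      rw [Finset.disjoint_left]
      intro v hv hvR
      obtain ⟨hvC, -⟩ := hS hv
      exact (hDQ (hR hvR).1).2.1 (hCP hvC).2
    have hle : (S ∪ R).card ≤ omegaOn G T := by
      refine card_le_omegaOn ?_ ?_
      · intro v hv
        obtain hv | hv := Finset.mem_union.1 hv
        · obtain ⟨hvC, -⟩ := hS hv
          exact (hCP hvC).1
        · exact (hDQ (hR hv).1).1
      · intro u hu v hv huv
        obtain hu | hu := Finset.mem_union.1 hu <;> obtain hv | hv := Finset.mem_union.1 hv
        · obtain ⟨huC, -⟩ := hS hu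
          obtain ⟨hvC, -⟩ := hS hv
          exact hP (hCP huC).2 (hCP hvC).2 huv
        · obtain ⟨huC, hus⟩ := hS hu
          exact (hR hv).2 _ hus
        · obtain ⟨hvC, hvs⟩ := hS hv
          exact ((hR hu).2 _ hvs).symm
        · exact hQ (hDQ (hR hu).1).2.2 (hDQ (hR hv).1).2.2 huv
    rw [Finset.card_union_of_disjoint hdisj, Finset.card_map] at hle
    have hsub : (D \ R).disjSum Finset.univ ⊆ s.biUnion t := by
      rintro (w | i) hw
      · simp only [Finset.inl_mem_disjSum, Finset.mem_sdiff] at hw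
        have : ∃ v ∈ s, ¬ G.Adj v w := by
          by_contra! h
          exact hw.2 (Finset.mem_filter.2 ⟨hw.1, h⟩)
        obtain ⟨v, hvs, hvw⟩ := this
        exact Finset.mem_biUnion.2 ⟨v, hvs, by simp [t, hw.1, hvw]⟩
      · exact Finset.mem_biUnion.2 ⟨v₀, hv₀, by simp [t]⟩
    have hRsub : R ⊆ D := Finset.filter_subset _ _
    have hcard := Finset.card_le_card hsub
    rw [Finset.card_disjSum, Finset.card_univ, Fintype.card_fin,
      Finset.card_sdiff_of_subset hRsub] at hcard
    have hRD : R.card ≤ D.card := Finset.card_le_card hRsub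
    omega
  obtain ⟨f, hf, hft⟩ := (Finset.all_card_le_biUnion_card_iff_exists_injective t).1 hall
  have hmemC (v : T) (h : (v : V) ∈ P) : (v : V) ∈ C := by simp [C, h]
  have hmemD (v : T) (h : (v : V) ∉ P) : (v : V) ∈ D := by simp [D, h]
  let K : Finset (V ⊕ Fin (omegaOn G T - D.card)) := D.disjSum Finset.univ
  let g : T → V ⊕ Fin (omegaOn G T - D.card) := fun v =>
    if h : (v : V) ∈ P then f ⟨v, hmemC v h⟩ else .inl v
  have hgP (v : T) (h : (v : V) ∈ P) : g v = f ⟨v, hmemC v h⟩ := dif_pos h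
  have hgQ (v : T) (h : (v : V) ∉ P) : g v = .inl (v : V) := dif_neg h
  have hgK (v : T) : g v ∈ K := by
    by_cases h : (v : V) ∈ P
    · rw [hgP v h]
      exact Finset.disjSum_mono (Finset.filter_subset _ _) subset_rfl (hft _)
    · rw [hgQ v h]
      exact Finset.inl_mem_disjSum.2 (hmemD v h)
  have hcross (u v : T) (hu : (u : V) ∈ P) (hv : (v : V) ∉ P) (huv : G.Adj u v) :
      g u ≠ g v := by
    intro heq
    rw [hgP u hu, hgQ v hv] at heq
    have := hft ⟨u, hmemC u hu⟩
    rw [heq] at this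
    exact (Finset.mem_filter.1 (Finset.inl_mem_disjSum.1 this)).2 huv
  have hcol : (G.induce T).Coloring K := by
    refine SimpleGraph.Coloring.mk (fun v => ⟨g v, hgK v⟩) ?_
    intro u v huv heq
    have huv' : G.Adj u v := huv
    have heq' : g u = g v := congrArg Subtype.val heq
    by_cases hu : (u : V) ∈ P <;> by_cases hv : (v : V) ∈ P
    · rw [hgP u hu, hgP v hv] at heq'
      exact huv'.ne (congrArg (fun x : C => (x : V)) (hf heq'))
    · exact hcross u v hu hv huv' heq'
    · exact hcross v u hv hu huv'.symm heq'.symm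
    · rw [hgQ u hu, hgQ v hv] at heq'
      exact huv'.ne (Sum.inl_injective heq')
  have := hcol.colorable
  rwa [Fintype.card_coe, Finset.card_disjSum, Finset.card_univ, Fintype.card_fin,
    Nat.add_sub_cancel' hDω] at this

/-- The clique `X` separates `P` from `Q`. -/
structure IsCliqueSep (G : SimpleGraph V) (P X Q : Set V) : Prop where
  left_nonempty : P.Nonempty
  right_nonempty : Q.Nonempty
  cover : ∀ v, v ∈ P ∨ v ∈ X ∨ v ∈ Q
  left_notMem : ∀ v ∈ P, v ∉ X
  right_notMem : ∀ v ∈ Q, v ∉ X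
  left_notMem_right : ∀ v ∈ P, v ∉ Q
  isClique : G.IsClique X
  not_adj : ∀ u ∈ P, ∀ v ∈ Q, ¬ G.Adj u v

/-- Each vertex of `X` has a neighbour in `P`. -/
def Attached (G : SimpleGraph V) (X P : Set V) : Prop :=
  ∀ x ∈ X, ∃ a ∈ P, G.Adj x a

lemma ClawFree.adj_or {G : SimpleGraph V} (h : ClawFree G) {a b c d : V} (hbc : b ≠ c)
    (hbd : b ≠ d) (hcd : c ≠ d) (hab : G.Adj a b) (hac : G.Adj a c) (had : G.Adj a d) :
    G.Adj b c ∨ G.Adj b d ∨ G.Adj c d := by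
  by_contra! hn
  exact h ⟨a, b, c, d, hbc, hbd, hcd, hab, hac, had, hn.1, hn.2.1, hn.2.2⟩

namespace IsCliqueSep

variable {G : SimpleGraph V} {P X Q : Set V}

lemma symm (h : IsCliqueSep G P X Q) : IsCliqueSep G Q X P where
  left_nonempty := h.right_nonempty
  right_nonempty := h.left_nonempty
  cover v := by have := h.cover v; tauto
  left_notMem := h.right_notMem
  right_notMem := h.left_notMem
  left_notMem_right v hv hv' := h.left_notMem_right v hv' hv
  isClique := h.isClique
  not_adj u hu v hv huv := h.not_adj v hv u hu huv.symm

/-- A vertex of the separator without neighbours in `P` can be moved to the other side. -/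
lemma move (h : IsCliqueSep G P X Q) {x : V} (hx : x ∈ X) (hxP : ∀ a ∈ P, ¬ G.Adj x a) :
    IsCliqueSep G P (X \ {x}) (insert x Q) where
  left_nonempty := h.left_nonempty
  right_nonempty := Set.insert_nonempty _ _
  cover v := by
    by_cases hv : v = x
    · simp [hv]
    · simpa [hv] using h.cover v
  left_notMem v hv hv' := h.left_notMem v hv hv'.1
  right_notMem v hv hv' := hv.elim hv'.2 fun hv => h.right_notMem v hv hv'.1
  left_notMem_right v hv hv' := by
    obtain rfl | hv' := hv'
    · exact h.left_notMem v hv hx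
    · exact h.left_notMem_right v hv hv'
  isClique := h.isClique.subset Set.sdiff_subset
  not_adj u hu v hv huv := by
    obtain rfl | hv := hv
    · exact hxP u hu huv.symm
    · exact h.not_adj u hu v hv huv

lemma exists_attached [Finite V] (h : IsCliqueSep G P X Q) :
    ∃ P X Q, IsCliqueSep G P X Q ∧ Attached G X P ∧ Attached G X Q := by
  obtain ⟨Y, ⟨P', Q', hY⟩, hmin⟩ :=
    (Set.toFinite {Y | ∃ P Q, IsCliqueSep G P Y Q}).exists_minimal ⟨X, P, Q, h⟩
  have hnot {x : V} (hx : x ∈ Y) {P Q : Set V} (hsep : IsCliqueSep G P (Y \ {x}) Q) : False :=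
    (hmin ⟨P, Q, hsep⟩ Set.sdiff_subset hx).2 rfl
  refine ⟨P', Y, Q', hY, fun x hx => ?_, fun x hx => ?_⟩
  · by_contra! hn
    exact hnot hx (hY.move hx hn)
  · by_contra! hn
    exact hnot hx (hY.symm.move hx hn)

lemma isClique_nbhd (h : IsCliqueSep G P X Q) (hclaw : ClawFree G) (hQ : Attached G X Q) {x : V}
    (hx : x ∈ X) {a b : V} (ha : a ∈ P) (hb : b ∈ P) (hxa : G.Adj x a) (hxb : G.Adj x b)
    (hab : a ≠ b) : G.Adj a b := by
  obtain ⟨c, hc, hxc⟩ := hQ x hx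
  have hne {v : V} (hv : v ∈ P) : v ≠ c := fun e => h.left_notMem_right v hv (e ▸ hc)
  obtain hadj | hadj | hadj := hclaw.adj_or hab (hne ha) (hne hb) hxa hxb hxc
  · exact hadj
  · exact (h.not_adj a ha c hc hadj).elim
  · exact (h.not_adj b hb c hc hadj).elim

lemma adj_or_adj (h : IsCliqueSep G P X Q) (hclaw : ClawFree G) {x y : V} (hx : x ∈ X)
    (hy : y ∈ X) {a b : V} (ha : a ∈ P) (hb : b ∈ Q) (hxa : G.Adj x a) (hxb : G.Adj x b) :
    G.Adj y a ∨ G.Adj y b := by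
  by_cases hxy : x = y
  · exact .inl (hxy ▸ hxa)
  have hya : y ≠ a := fun e => h.left_notMem a ha (e ▸ hy)
  have hyb : y ≠ b := fun e => h.right_notMem b hb (e ▸ hy)
  have hab : a ≠ b := fun e => h.left_notMem_right a ha (e ▸ hb)
  obtain hadj | hadj | hadj := hclaw.adj_or hya hyb hab (h.isClique hx hy hxy) hxa hxb
  · exact .inl hadj
  · exact .inr hadj
  · exact (h.not_adj a ha b hb hadj).elim

/-- Either some vertex of the separator dominates all its neighbours in `Q`, or the neighbours of
the separator in `P` form a clique. -/
lemma exists_dominating_or_isClique [Finite V] (h : IsCliqueSep G P X Q) (hclaw : ClawFree G)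
    (hP : Attached G X P) (hQ : Attached G X Q) :
    (∃ x₀ ∈ X, ∀ x ∈ X, ∀ v ∈ Q, G.Adj x v → G.Adj x₀ v) ∨
      G.IsClique {v | v ∈ P ∧ ∃ x ∈ X, G.Adj x v} := by
  obtain rfl | hX := X.eq_empty_or_nonempty
  · exact .inr (by simp)
  obtain ⟨x, hx, hmax⟩ := Set.Finite.exists_maximalFor (fun x => {v | v ∈ Q ∧ G.Adj x v}) X
    (Set.toFinite X) hX
  refine or_iff_not_imp_left.2 fun hn => ?_
  push Not at hn
  obtain ⟨x', hx', v₀, hv₀, hx'v₀, hxv₀⟩ := hn x hx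
  have hsub {y w : V} (hy : y ∈ X) (hw : w ∈ Q) (hxw : G.Adj x w) (hyw : ¬ G.Adj y w) {a : V}
      (ha : a ∈ P) (hxa : G.Adj x a) : G.Adj y a :=
    (h.adj_or_adj hclaw hx hy ha hw hxa hxw).resolve_right hyw
  have hcomp {y : V} (hy : y ∈ X) (hyv₀ : G.Adj y v₀) :
      ∃ w ∈ Q, G.Adj x w ∧ ¬ G.Adj y w := by
    by_contra! hle
    exact hxv₀ (hmax hy (fun w hw => ⟨hw.1, hle w hw.1 hw.2⟩) ⟨hv₀, hyv₀⟩).2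
  have hmin {y a : V} (hy : y ∈ X) (ha : a ∈ P) (hxa : G.Adj x a) : G.Adj y a := by
    by_cases hyv₀ : G.Adj y v₀
    · obtain ⟨w, hw, hxw, hyw⟩ := hcomp hy hyv₀
      exact hsub hy hw hxw hyw ha hxa
    · obtain ⟨w, hw, hxw, hx'w⟩ := hcomp hx' hx'v₀
      exact (h.adj_or_adj hclaw hx' hy ha hv₀ (hsub hx' hw hxw hx'w ha hxa)
        hx'v₀).resolve_right hyv₀
  obtain ⟨k, hk, hxk⟩ := hP x hx
  rintro a ⟨ha, y, hy, hya⟩ b ⟨hb, z, hz, hzb⟩ hab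
  by_contra hnab
  have hxa : ¬ G.Adj x a := fun hxa =>
    hnab (h.isClique_nbhd hclaw hQ hz ha hb (hmin hz ha hxa) hzb hab)
  have hxb : ¬ G.Adj x b := fun hxb =>
    hnab (h.isClique_nbhd hclaw hQ hy ha hb hya (hmin hy hb hxb) hab)
  have hka : G.Adj k a := h.isClique_nbhd hclaw hQ hy hk ha (hmin hy hk hxk) hya
    fun e => hxa (e ▸ hxk)
  have hkb : G.Adj k b := h.isClique_nbhd hclaw hQ hz hk hb (hmin hz hk hxk) hzb
    fun e => hxb (e ▸ hxk)
  have hxa' : x ≠ a := fun e => h.left_notMem a ha (e ▸ hx)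
  have hxb' : x ≠ b := fun e => h.left_notMem b hb (e ▸ hx)
  obtain hadj | hadj | hadj := hclaw.adj_or hxa' hxb' hab hxk.symm hka hkb
  exacts [hxa hadj, hxb hadj, hnab hadj]

/-- Adding part of the separator to a perfect subgraph of one side keeps it perfect if the
attachment on this side is a clique. -/
lemma isPerfectOn_union [Finite V] (h : IsCliqueSep G P X Q)
    (hPX : G.IsClique {v | v ∈ P ∧ ∃ x ∈ X, G.Adj x v}) {A S : Set V} (hA : IsPerfectOn G A)
    (hAP : A ⊆ P) (hS : S ⊆ X) : IsPerfectOn G (A ∪ S) := by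
  have hY : G.IsClique (A ∩ {v | v ∈ P ∧ ∃ x ∈ X, G.Adj x v}) := hPX.subset Set.inter_subset_right
  have hglue := hA.union (isPerfectOn_union_of_isClique hY (h.isClique.subset hS)) ?_ ?_
  · refine hglue.mono ?_
    rintro v (hv | hv)
    exacts [.inl hv, .inr (.inr hv)]
  · refine hY.subset ?_
    rintro v ⟨hv, hv' | hv'⟩
    exacts [hv', (h.left_notMem v (hAP hv) (hS hv')).elim]
  · rintro u ⟨hu, hu'⟩ v ⟨hv | hv, hv'⟩ huv
    · exact hv' hv.1
    · exact hu' (.inl ⟨hu, hAP hu, v, hS hv, huv.symm⟩)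

lemma isPerfectOn_union_union [Finite V] (h : IsCliqueSep G P X Q) {A B S : Set V}
    (hA : A ⊆ P) (hB : B ⊆ Q) (hS : S ⊆ X) (hAS : IsPerfectOn G (A ∪ S))
    (hBS : IsPerfectOn G (B ∪ S)) : IsPerfectOn G ((A ∪ S) ∪ (B ∪ S)) := by
  refine hAS.union hBS (h.isClique.subset ?_) ?_
  · rintro v ⟨hv | hv, hv' | hv'⟩
    exacts [(h.left_notMem_right v (hA hv) (hB hv')).elim, hS hv', hS hv, hS hv]
  · rintro u ⟨hu | hu, hu'⟩ v ⟨hv | hv, hv'⟩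
    exacts [h.not_adj u (hA hu) v (hB hv), (hv' (.inr hv)).elim, (hu' (.inr hu)).elim,
      (hu' (.inr hu)).elim]

end IsCliqueSep

namespace MNPD

variable {G : SimpleGraph V} {P X Q : Set V}

/-- No perfect subgraph meets all maximum cliques. -/
lemma exists_isClique [Finite V] (hG : MNPD G) {A : Set V} (hA : IsPerfectOn G A) :
    ∃ s : Finset V, G.IsClique s ∧ Disjoint (s : Set V) A ∧ omegaOn G Set.univ ≤ s.card := by
  by_contra! hn
  refine hG.1 fun H _ hH => ?_
  by_cases hHu : H = Set.univ
  · subst hHu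
    exact ⟨A, Aᶜ, Set.union_compl_self A, disjoint_compl_right, hA,
      omegaOn_lt_iff.2 fun s hs hcl => hn s hcl (Set.disjoint_left.2 hs)⟩
  · exact hG.2 H hHu H subset_rfl hH

lemma exists_isPerfectOn [Finite V] (hG : MNPD G) {H : Set V} (hH : H.Nonempty)
    (hHu : H ≠ Set.univ) :
    ∃ A ⊆ H, IsPerfectOn G A ∧ ∀ s : Finset V, ↑s ⊆ H → G.IsClique s →
      Disjoint (s : Set V) A → s.card < omegaOn G Set.univ := by
  obtain ⟨A, B, rfl, -, hA, hB⟩ := hG.2 H hHu H subset_rfl hH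
  refine ⟨A, Set.subset_union_left, hA, fun s hs hcl hsA => ?_⟩
  exact (omegaOn_lt_iff.1 hB s (fun v hv => (hs hv).resolve_left (Set.disjoint_left.1 hsA hv))
    hcl).trans_le (omegaOn_mono G (Set.subset_univ _))

lemma not_isClique_of_isClique [Finite V] (hG : MNPD G) (h : IsCliqueSep G P X Q)
    (hPX : G.IsClique {v | v ∈ P ∧ ∃ x ∈ X, G.Adj x v}) :
    ¬ G.IsClique {v | v ∈ Q ∧ ∃ x ∈ X, G.Adj x v} := by
  intro hQX
  obtain ⟨p, hp⟩ := h.left_nonempty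
  obtain ⟨q, hq⟩ := h.right_nonempty
  obtain ⟨A, hAP, hA, hAω⟩ := hG.exists_isPerfectOn h.left_nonempty
    fun e => h.left_notMem_right q (e ▸ Set.mem_univ q) hq
  obtain ⟨B, hBQ, hB, hBω⟩ := hG.exists_isPerfectOn h.right_nonempty
    fun e => h.left_notMem_right p hp (e ▸ Set.mem_univ p)
  obtain ⟨s, hs, hsd, hsω⟩ := hG.exists_isClique (h.isPerfectOn_union_union hAP hBQ subset_rfl
    (h.isPerfectOn_union hPX hA hAP subset_rfl) (h.symm.isPerfectOn_union hQX hB hBQ subset_rfl))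
  have hsX {v : V} (hv : v ∈ s) : v ∉ X := fun hvX =>
    Set.disjoint_left.1 hsd hv (.inl (.inr hvX))
  have hsP : ¬ (s : Set V) ⊆ P := fun hsP =>
    (hAω s hsP hs (hsd.mono_right fun v hv => .inl (.inl hv))).not_ge hsω
  have hsQ : ¬ (s : Set V) ⊆ Q := fun hsQ =>
    (hBω s hsQ hs (hsd.mono_right fun v hv => .inr (.inl hv))).not_ge hsω
  obtain ⟨v, hv, hvP⟩ := Set.not_subset.1 hsP
  obtain ⟨u, hu, huQ⟩ := Set.not_subset.1 hsQ
  have huP : u ∈ P := (h.cover u).resolve_right fun h' => h'.elim (hsX hu) huQ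
  have hvQ : v ∈ Q := ((h.cover v).resolve_left hvP).resolve_left (hsX hv)
  exact h.not_adj u huP v hvQ (hs hu hv fun e => huQ (e ▸ hvQ))

lemma not_exists_dominating [Finite V] (hG : MNPD G) (h : IsCliqueSep G P X Q)
    (hclaw : ClawFree G) (hP : Attached G X P) (hQ : Attached G X Q) :
    ¬ ∃ x₀ ∈ X, ∀ x ∈ X, ∀ v ∈ Q, G.Adj x v → G.Adj x₀ v := by
  classical
  rintro ⟨x₀, hx₀, hdom⟩
  have hQX : G.IsClique {v | v ∈ Q ∧ ∃ x ∈ X, G.Adj x v} := by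
    rintro a ⟨ha, x, hx, hxa⟩ b ⟨hb, y, hy, hyb⟩ hab
    exact h.symm.isClique_nbhd hclaw hP hx₀ ha hb (hdom x hx a ha hxa) (hdom y hy b hb hyb) hab
  obtain ⟨p, hp⟩ := h.left_nonempty
  obtain ⟨q, hq⟩ := h.right_nonempty
  obtain ⟨B, hBQ, hB, hBω⟩ := hG.exists_isPerfectOn h.right_nonempty
    fun e => h.left_notMem_right p hp (e ▸ Set.mem_univ p)
  obtain ⟨A₁, hA₁PX, hA₁, hA₁ω⟩ := hG.exists_isPerfectOn (H := P ∪ X) ⟨p, .inl hp⟩ fun e =>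
    (e ▸ Set.mem_univ q : q ∈ P ∪ X).elim (fun hqP => h.left_notMem_right q hqP hq)
      (h.right_notMem q hq)
  obtain ⟨A, hA₁A, hAPX, hA, y₀, hy₀, hy₀A, hdom'⟩ : ∃ A, A₁ ⊆ A ∧ A ⊆ P ∪ X ∧
      IsPerfectOn G A ∧ ∃ y₀ ∈ X, y₀ ∈ A ∧ ∀ x ∈ X, ∀ v ∈ Q, G.Adj x v → G.Adj y₀ v := by
    by_cases hex : ∃ y₀ ∈ X, y₀ ∈ A₁ ∧ ∀ x ∈ X, ∀ v ∈ Q, G.Adj x v → G.Adj y₀ v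
    · exact ⟨A₁, subset_rfl, hA₁PX, hA₁, hex⟩
    have hx₀A₁ : x₀ ∉ A₁ := fun hmem => hex ⟨x₀, hx₀, hmem, hdom⟩
    have hsimp {a x : V} (ha : a ∈ P) (hx₀a : G.Adj x₀ a) (hx : x ∈ X) (hxA₁ : x ∈ A₁) :
        G.Adj x a := by
      by_contra hxa
      refine hex ⟨x, hx, hxA₁, fun y hy v hv hyv => ?_⟩
      exact (h.adj_or_adj hclaw hx₀ hx ha hv hx₀a (hdom y hy v hv hyv)).resolve_left hxa
    have hN : G.IsClique {v | v ∈ A₁ ∧ G.Adj x₀ v} := by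
      rintro a ⟨ha, hx₀a⟩ b ⟨hb, hx₀b⟩ hab
      obtain haP | haX := hA₁PX ha <;> obtain hbP | hbX := hA₁PX hb
      · exact h.isClique_nbhd hclaw hQ hx₀ haP hbP hx₀a hx₀b hab
      · exact (hsimp haP hx₀a hbX hb).symm
      · exact hsimp hbP hx₀b haX ha
      · exact h.isClique haX hbX hab
    refine ⟨insert x₀ A₁, Set.subset_insert _ _, Set.insert_subset (.inr hx₀) hA₁PX, ?_,
      x₀, hx₀, Set.mem_insert _ _, hdom⟩
    have hglue := hA₁.union (isPerfectOn_union_of_isClique hN (Set.pairwise_singleton x₀ _)) ?_ ?_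
    · refine hglue.mono ?_
      rintro v (rfl | hv)
      exacts [.inr (.inr rfl), .inl hv]
    · refine hN.subset ?_
      rintro v ⟨hv, hv' | rfl⟩
      exacts [hv', (hx₀A₁ hv).elim]
    · rintro u ⟨hu, hu'⟩ v ⟨hv | rfl, hv'⟩ huv
      exacts [hv' hv.1, hu' (.inl ⟨hu, huv.symm⟩)]
  have hAsplit : A ⊆ (A ∩ P) ∪ (A ∩ X) := fun v hv =>
    (hAPX hv).imp (fun hvP => ⟨hv, hvP⟩) fun hvX => ⟨hv, hvX⟩
  have hperf := h.isPerfectOn_union_union (S := A ∩ X) Set.inter_subset_right hBQ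
    Set.inter_subset_right
    (hA.mono (Set.union_subset Set.inter_subset_left Set.inter_subset_left))
    (h.symm.isPerfectOn_union hQX hB hBQ Set.inter_subset_right)
  obtain ⟨s, hs, hsd, hsω⟩ := hG.exists_isClique hperf
  have hsA : Disjoint (s : Set V) A := hsd.mono_right fun v hv => .inl (hAsplit hv)
  have hsPX : ¬ (s : Set V) ⊆ P ∪ X := fun hsPX =>
    (hA₁ω s hsPX hs (hsA.mono_right hA₁A)).not_ge hsω
  have hsQ : ¬ (s : Set V) ⊆ Q := fun hsQ =>
    (hBω s hsQ hs (hsd.mono_right fun v hv => .inr (.inl hv))).not_ge hsω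
  obtain ⟨v, hv, hvPX⟩ := Set.not_subset.1 hsPX
  obtain ⟨x, hx, hxQ⟩ := Set.not_subset.1 hsQ
  have hvQ : v ∈ Q := ((h.cover v).resolve_left fun h' => hvPX (.inl h')).resolve_left
    fun h' => hvPX (.inr h')
  have hsP {u : V} (hu : u ∈ s) : u ∉ P := fun huP =>
    h.not_adj u huP v hvQ (hs hu hv fun e => hvPX (.inl (e ▸ huP)))
  have hxX : x ∈ X := ((h.cover x).resolve_left (hsP hx)).resolve_right hxQ
  have hy₀s : y₀ ∉ s := fun hmem => Set.disjoint_left.1 hsA hmem hy₀A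
  have hcl : G.IsClique (insert y₀ s : Finset V) := by
    rw [Finset.coe_insert]
    refine hs.insert fun u hu hne => ?_
    obtain huP | huX | huQ := h.cover u
    · exact (hsP hu huP).elim
    · exact h.isClique hy₀ huX hne
    · exact hdom' x hxX u huQ (hs hx hu fun e => hxQ (e ▸ huQ))
  have hcard := card_le_omegaOn (Set.subset_univ _) hcl
  rw [Finset.card_insert_of_notMem hy₀s] at hcard
  omega

end MNPD

lemma exists_isCliqueSep {G : SimpleGraph V} {X : Set V} (hX : G.IsClique X)
    (hdis : ¬ (G.induce Xᶜ).Preconnected) : ∃ P Q, IsCliqueSep G P X Q := by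
  unfold SimpleGraph.Preconnected at hdis
  push Not at hdis
  obtain ⟨u, w, huw⟩ := hdis
  refine ⟨{v | ∃ h : v ∈ Xᶜ, (G.induce Xᶜ).Reachable u ⟨v, h⟩},
    {v | ∃ h : v ∈ Xᶜ, ¬ (G.induce Xᶜ).Reachable u ⟨v, h⟩}, ?_⟩
  refine ⟨⟨u, u.2, .rfl⟩, ⟨w, w.2, huw⟩, fun v => ?_, fun v hv => hv.1, fun v hv => hv.1,
    fun v ⟨hv, hr⟩ ⟨_, hn⟩ => hn hr, hX, ?_⟩
  · by_cases hv : v ∈ X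
    · exact .inr (.inl hv)
    · by_cases hr : (G.induce Xᶜ).Reachable u ⟨v, hv⟩
      exacts [.inl ⟨hv, hr⟩, .inr (.inr ⟨hv, hr⟩)]
  · rintro a ⟨ha, hra⟩ b ⟨hb, hrb⟩ hab
    have hab' : (G.induce Xᶜ).Adj ⟨a, ha⟩ ⟨b, hb⟩ := hab
    exact hrb (hra.trans hab'.reachable)

theorem stmt_15 [Fintype V] (G : SimpleGraph V) (hclaw : ClawFree G)
    (hG : MNPD G) (hc : G.Connected) :
    ¬ ∃ X : Set V, G.IsClique X ∧ ¬ (G.induce Xᶜ).Preconnected := by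
  rintro ⟨X, hX, hdis⟩
  obtain ⟨P, Q, hsep⟩ := exists_isCliqueSep hX hdis
  obtain ⟨P, X, Q, h, hP, hQ⟩ := hsep.exists_attached
  refine hG.not_isClique_of_isClique h ?_ ?_
  · exact (h.exists_dominating_or_isClique hclaw hP hQ).resolve_left
      (hG.not_exists_dominating h hclaw hP hQ)
  · exact (h.symm.exists_dominating_or_isClique hclaw hQ hP).resolve_left
      (hG.not_exists_dominating h.symm hclaw hQ hP)
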